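/- Let X, Y¹, Y² be standard Borel spaces, ζ a Borel probability measure on X, and P an information structure on X × Y¹ × Y² satisfying Assumption 2.1. Then for every Markov kernel κ¹ from Y¹ to Y¹ and every Markov kernel κ² from Y² to Y², and for every game in the class G̃ (nonempty compact metric action spaces U¹, U² and bounded jointly measurable cost c : X × U¹ × U² → ℝ continuous in (u¹,u²) for every x), the values satisfy V*(κ²P) ≤ V*(P) and V*(P) ≤ V*(κ¹P); that is, κ²P ≲ P and P ≲ κ¹P. -/

import Mathlib

open MeasureTheory ProbabilityTheory

/-- The value `V*(P)` of the zero-sum game with information structure `P` and cost `c`: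
the infimum over the minimizer's randomized policies (Markov kernels from `Y₁` to `U₁`) of
the supremum over the maximizer's randomized policies (Markov kernels from `Y₂` to `U₂`)
of the expected cost. -/
noncomputable def gameValue {X Y₁ Y₂ U₁ U₂ : Type*}
    [MeasurableSpace X] [MeasurableSpace Y₁] [MeasurableSpace Y₂]
    [MeasurableSpace U₁] [MeasurableSpace U₂]
    (P : Measure (X × Y₁ × Y₂)) (c : X → U₁ → U₂ → ℝ) : ℝ :=
  ⨅ γ₁ : {κ : Kernel Y₁ U₁ // IsMarkovKernel κ},
    ⨆ γ₂ : {κ : Kernel Y₂ U₂ // IsMarkovKernel κ},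
      ∫ p : X × Y₁ × Y₂, ∫ u₁, ∫ u₂, c p.1 u₁ u₂ ∂(γ₂.1 p.2.2) ∂(γ₁.1 p.2.1) ∂P

open Set

lemma abs_integral_le_of_abs_le {Ω : Type*} [MeasurableSpace Ω] (μ : Measure Ω)
    [IsProbabilityMeasure μ] {f : Ω → ℝ} {M : ℝ} (hf : ∀ ω, |f ω| ≤ M) :
    |∫ ω, f ω ∂μ| ≤ M := by
  simpa using norm_integral_le_of_norm_le_const (μ := μ) (f := f) (ae_of_all _ hf)

section ExpectedCost

variable {X Y₁ Y₂ U₁ U₂ : Type*} [MeasurableSpace X] [MeasurableSpace Y₁] [MeasurableSpace Y₂]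
  [MeasurableSpace U₁] [MeasurableSpace U₂]

/-- The expected cost of a pair of randomized policies. -/
noncomputable def expectedCost (P : Measure (X × Y₁ × Y₂)) (c : X → U₁ → U₂ → ℝ)
    (γ₁ : Kernel Y₁ U₁) (γ₂ : Kernel Y₂ U₂) : ℝ :=
  ∫ p : X × Y₁ × Y₂, ∫ u₁, ∫ u₂, c p.1 u₁ u₂ ∂(γ₂ p.2.2) ∂(γ₁ p.2.1) ∂P

lemma gameValue_eq_iInf_iSup_expectedCost (P : Measure (X × Y₁ × Y₂)) (c : X → U₁ → U₂ → ℝ) :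
    gameValue P c = ⨅ γ₁ : {κ : Kernel Y₁ U₁ // IsMarkovKernel κ},
      ⨆ γ₂ : {κ : Kernel Y₂ U₂ // IsMarkovKernel κ}, expectedCost P c γ₁.1 γ₂.1 :=
  rfl

lemma abs_expectedCost_le (P : Measure (X × Y₁ × Y₂)) [IsProbabilityMeasure P]
    {c : X → U₁ → U₂ → ℝ} {M : ℝ} (hM : ∀ x u₁ u₂, |c x u₁ u₂| ≤ M)
    (γ₁ : Kernel Y₁ U₁) [IsMarkovKernel γ₁] (γ₂ : Kernel Y₂ U₂) [IsMarkovKernel γ₂] :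
    |expectedCost P c γ₁ γ₂| ≤ M := by
  exact abs_integral_le_of_abs_le _ fun _ ↦ abs_integral_le_of_abs_le _ fun _ ↦
    abs_integral_le_of_abs_le _ fun _ ↦ hM _ _ _

/-- The expected cost is the integral of the cost against the joint law of the state and the
actions. -/
lemma expectedCost_eq_integral_comp (P : Measure (X × Y₁ × Y₂)) [IsProbabilityMeasure P]
    {c : X → U₁ → U₂ → ℝ} {M : ℝ} (hM : ∀ x u₁ u₂, |c x u₁ u₂| ≤ M)
    (hc : Measurable fun p : X × U₁ × U₂ ↦ c p.1 p.2.1 p.2.2)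
    (γ₁ : Kernel Y₁ U₁) [IsMarkovKernel γ₁] (γ₂ : Kernel Y₂ U₂) [IsMarkovKernel γ₂] :
    expectedCost P c γ₁ γ₂ =
      ∫ q, c q.1 q.2.1 q.2.2 ∂(((Kernel.id : Kernel X X) ∥ₖ (γ₁ ∥ₖ γ₂)) ∘ₘ P) := by
  rw [← Measure.snd_compProd, Measure.snd, integral_map measurable_snd.aemeasurable
    hc.aestronglyMeasurable, Measure.integral_compProd]
  · refine integral_congr_ae (ae_of_all _ fun p ↦ ?_)
    have hmk : Measurable fun u : U₁ × U₂ ↦ (p.1, u) := by fun_prop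
    simp only [Kernel.parallelComp_apply, Kernel.id_apply, Measure.dirac_prod]
    rw [integral_map hmk.aemeasurable hc.aestronglyMeasurable, integral_prod]
    exact .of_bound (hc.comp hmk).aestronglyMeasurable M (ae_of_all _ fun _ ↦ hM _ _ _)
  · exact .of_bound (hc.comp measurable_snd).aestronglyMeasurable M
      (ae_of_all _ fun _ ↦ hM _ _ _)

/-- Garbling the measurements amounts to precomposing the policies with the garbling kernels. -/
lemma expectedCost_parallelComp_comp (P : Measure (X × Y₁ × Y₂)) [IsProbabilityMeasure P]
    {c : X → U₁ → U₂ → ℝ} {M : ℝ} (hM : ∀ x u₁ u₂, |c x u₁ u₂| ≤ M)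
    (hc : Measurable fun p : X × U₁ × U₂ ↦ c p.1 p.2.1 p.2.2)
    (κ₁ : Kernel Y₁ Y₁) [IsMarkovKernel κ₁] (κ₂ : Kernel Y₂ Y₂) [IsMarkovKernel κ₂]
    (γ₁ : Kernel Y₁ U₁) [IsMarkovKernel γ₁] (γ₂ : Kernel Y₂ U₂) [IsMarkovKernel γ₂] :
    expectedCost ((Kernel.id ∥ₖ (κ₁ ∥ₖ κ₂)) ∘ₘ P) c γ₁ γ₂ =
      expectedCost P c (γ₁ ∘ₖ κ₁) (γ₂ ∘ₖ κ₂) := by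
  rw [expectedCost_eq_integral_comp _ hM hc, expectedCost_eq_integral_comp _ hM hc,
    Measure.comp_assoc, Kernel.parallelComp_comp_parallelComp,
    Kernel.parallelComp_comp_parallelComp, Kernel.id_comp]

lemma eq_parallelComp_id_comp_of_prod {P P₁ : Measure (X × Y₁ × Y₂)} [IsFiniteMeasure P₁]
    {κ₁ : Kernel Y₁ Y₁} [IsSFiniteKernel κ₁]
    (h : ∀ (A : Set X) (B : Set Y₁) (C : Set Y₂),
      MeasurableSet A → MeasurableSet B → MeasurableSet C →
      P₁ (A ×ˢ B ×ˢ C) = ∫⁻ p in A ×ˢ (univ ×ˢ C), κ₁ p.2.1 B ∂P) :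
    P₁ = (Kernel.id ∥ₖ (κ₁ ∥ₖ Kernel.id)) ∘ₘ P := by
  refine Measure.ext_prod₃ fun {A B C} hA hB hC ↦ ?_
  rw [h A B C hA hB hC, Measure.bind_apply (hA.prod (hB.prod hC)) (Kernel.aemeasurable _),
    ← lintegral_indicator (hA.prod (MeasurableSet.univ.prod hC))]
  refine lintegral_congr fun p ↦ ?_
  rw [Kernel.parallelComp_apply_prod, Kernel.parallelComp_apply_prod, Kernel.id_apply,
    Kernel.id_apply, Measure.dirac_apply' _ hA, Measure.dirac_apply' _ hC]
  by_cases h₁ : p.1 ∈ A <;> by_cases h₂ : p.2.2 ∈ C <;> simp [h₁, h₂]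

lemma eq_id_parallelComp_comp_of_prod {P P₂ : Measure (X × Y₁ × Y₂)} [IsFiniteMeasure P₂]
    {κ₂ : Kernel Y₂ Y₂} [IsSFiniteKernel κ₂]
    (h : ∀ (A : Set X) (B : Set Y₁) (C : Set Y₂),
      MeasurableSet A → MeasurableSet B → MeasurableSet C →
      P₂ (A ×ˢ B ×ˢ C) = ∫⁻ p in A ×ˢ (B ×ˢ univ), κ₂ p.2.2 C ∂P) :
    P₂ = (Kernel.id ∥ₖ (Kernel.id ∥ₖ κ₂)) ∘ₘ P := by
  refine Measure.ext_prod₃ fun {A B C} hA hB hC ↦ ?_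
  rw [h A B C hA hB hC, Measure.bind_apply (hA.prod (hB.prod hC)) (Kernel.aemeasurable _),
    ← lintegral_indicator (hA.prod (hB.prod MeasurableSet.univ))]
  refine lintegral_congr fun p ↦ ?_
  rw [Kernel.parallelComp_apply_prod, Kernel.parallelComp_apply_prod, Kernel.id_apply,
    Kernel.id_apply, Measure.dirac_apply' _ hA, Measure.dirac_apply' _ hB]
  by_cases h₁ : p.1 ∈ A <;> by_cases h₂ : p.2.1 ∈ B <;> simp [h₁, h₂]

instance nonempty_markovKernel [Nonempty U₁] :
    Nonempty {κ : Kernel Y₁ U₁ // IsMarkovKernel κ} :=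
  ⟨⟨Kernel.const _ (Measure.dirac (Classical.arbitrary U₁)), inferInstance⟩⟩

lemma bddAbove_range_expectedCost (P : Measure (X × Y₁ × Y₂)) [IsProbabilityMeasure P]
    {c : X → U₁ → U₂ → ℝ} {M : ℝ} (hM : ∀ x u₁ u₂, |c x u₁ u₂| ≤ M)
    (γ₁ : Kernel Y₁ U₁) [IsMarkovKernel γ₁] :
    BddAbove (range fun γ₂ : {κ : Kernel Y₂ U₂ // IsMarkovKernel κ} ↦
      expectedCost P c γ₁ γ₂.1) := by
  refine ⟨M, ?_⟩
  rintro _ ⟨⟨γ₂, _⟩, rfl⟩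
  exact (abs_le.mp (abs_expectedCost_le P hM γ₁ γ₂)).2

lemma bddBelow_range_iSup_expectedCost [Nonempty U₂]
    (P : Measure (X × Y₁ × Y₂)) [IsProbabilityMeasure P]
    {c : X → U₁ → U₂ → ℝ} {M : ℝ} (hM : ∀ x u₁ u₂, |c x u₁ u₂| ≤ M) :
    BddBelow (range fun γ₁ : {κ : Kernel Y₁ U₁ // IsMarkovKernel κ} ↦
      ⨆ γ₂ : {κ : Kernel Y₂ U₂ // IsMarkovKernel κ}, expectedCost P c γ₁.1 γ₂.1) := by
  refine ⟨-M, ?_⟩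
  rintro _ ⟨⟨γ₁, _⟩, rfl⟩
  obtain ⟨γ₂, hγ₂⟩ := nonempty_markovKernel (Y₁ := Y₂) (U₁ := U₂)
  exact (abs_le.mp (abs_expectedCost_le P hM γ₁ γ₂)).1.trans
    (le_ciSup (bddAbove_range_expectedCost P hM γ₁) ⟨γ₂, hγ₂⟩)

end ExpectedCost

/-- Garbling the maximizer's measurement never helps the maximizer, and
garbling the minimizer's measurement never helps the minimizer: for an information
structure `P` satisfying Assumption 2.1, and any Markov kernels `κ₁`, `κ₂` garbling the
respective coordinates, `V*(κ₂P) ≤ V*(P)` and `V*(P) ≤ V*(κ₁P)` for every game in the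
class `G̃`. -/
theorem garbling_ordering
    {X Y₁ Y₂ : Type*} [MeasurableSpace X] [StandardBorelSpace X]
    [MeasurableSpace Y₁] [StandardBorelSpace Y₁]
    [MeasurableSpace Y₂] [StandardBorelSpace Y₂]
    (ζ : Measure X) [IsProbabilityMeasure ζ]
    (P : Measure (X × Y₁ × Y₂)) [IsProbabilityMeasure P]
    (hmarg : P.map Prod.fst = ζ)
    (hac : ∃ (Q₁ : Measure Y₁) (Q₂ : Measure Y₂), IsProbabilityMeasure Q₁ ∧
      IsProbabilityMeasure Q₂ ∧ P ≪ ζ.prod (Q₁.prod Q₂))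
    (κ₁ : Kernel Y₁ Y₁) [IsMarkovKernel κ₁]
    (κ₂ : Kernel Y₂ Y₂) [IsMarkovKernel κ₂]
    (P₁ P₂ : Measure (X × Y₁ × Y₂)) [IsProbabilityMeasure P₁] [IsProbabilityMeasure P₂]
    (hP₁ : ∀ (A : Set X) (B : Set Y₁) (C : Set Y₂),
      MeasurableSet A → MeasurableSet B → MeasurableSet C →
      P₁ (A ×ˢ B ×ˢ C) = ∫⁻ p in A ×ˢ ((Set.univ : Set Y₁) ×ˢ C), κ₁ p.2.1 B ∂P)
    (hP₂ : ∀ (A : Set X) (B : Set Y₁) (C : Set Y₂),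
      MeasurableSet A → MeasurableSet B → MeasurableSet C →
      P₂ (A ×ˢ B ×ˢ C) = ∫⁻ p in A ×ˢ (B ×ˢ (Set.univ : Set Y₂)), κ₂ p.2.2 C ∂P)
    {U₁ U₂ : Type*} [MetricSpace U₁] [CompactSpace U₁] [Nonempty U₁]
    [MeasurableSpace U₁] [BorelSpace U₁]
    [MetricSpace U₂] [CompactSpace U₂] [Nonempty U₂]
    [MeasurableSpace U₂] [BorelSpace U₂]
    (c : X → U₁ → U₂ → ℝ)
    (hbdd : ∃ M : ℝ, ∀ x u₁ u₂, |c x u₁ u₂| ≤ M)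
    (hmeas : Measurable fun p : X × U₁ × U₂ => c p.1 p.2.1 p.2.2)
    (hcont : ∀ x, Continuous fun q : U₁ × U₂ => c x q.1 q.2) :
    gameValue (U₁ := U₁) (U₂ := U₂) P₂ c ≤ gameValue (U₁ := U₁) (U₂ := U₂) P c ∧
      gameValue (U₁ := U₁) (U₂ := U₂) P c ≤ gameValue (U₁ := U₁) (U₂ := U₂) P₁ c := by
  obtain ⟨M, hM⟩ := hbdd
  simp only [gameValue_eq_iInf_iSup_expectedCost]
  constructor
  · refine ciInf_mono (bddBelow_range_iSup_expectedCost P₂ hM) ?_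
    rintro ⟨γ₁, _⟩
    refine ciSup_le ?_
    rintro ⟨γ₂, _⟩
    have key : expectedCost P₂ c γ₁ γ₂ = expectedCost P c γ₁ (γ₂ ∘ₖ κ₂) := by
      rw [eq_id_parallelComp_comp_of_prod hP₂, expectedCost_parallelComp_comp P hM hmeas,
        Kernel.comp_id]
    rw [key]
    exact le_ciSup (bddAbove_range_expectedCost P hM γ₁) ⟨γ₂ ∘ₖ κ₂, inferInstance⟩
  · refine le_ciInf ?_
    rintro ⟨γ₁, _⟩
    have key (γ₂ : {κ : Kernel Y₂ U₂ // IsMarkovKernel κ}) :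
        expectedCost P₁ c γ₁ γ₂.1 = expectedCost P c (γ₁ ∘ₖ κ₁) γ₂.1 := by
      have := γ₂.2
      rw [eq_parallelComp_id_comp_of_prod hP₁, expectedCost_parallelComp_comp P hM hmeas,
        Kernel.comp_id]
    simp only [key]
    exact ciInf_le (bddBelow_range_iSup_expectedCost P hM) ⟨γ₁ ∘ₖ κ₁, inferInstance⟩
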